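/- Let L1 be a real symmetric 5×5 matrix such that the family L(t) := cos(t)·L0 + sin(t)·L1 is isospectral, and suppose P_4 = L_+^4 ≠ 0. Then there exist a real orthogonal 5×5 matrix U, a complex 1×3 row vector F₀, and complex numbers G₁, G₃ such that, writing G for the 3×3 complex symmetric matrix whose upper-left 2×2 block is G₁·σ, whose (1,3)–(2,3) column is e_+·G₃ (and (3,1)–(3,2) row is e_+^T·G₃) and whose (3,3) entry is 0, one has U·L_+·U^T = [[0, e_+⊗F₀^T-structure], i.e. U·L_+·U^T is the block matrix [[0₂ₓ₂, e_+⊗F₀],[e_+^T⊗F₀^T, G]]; moreover U·P_4·U^T has upper-left 2×2 block (F₀·G²·F₀^T)·σ and all other entries zero, U·L_+²·U^T has the block form of Lemma prol2 with B₀ = F₀·F₀^T, D = G², d₂ = 1, and D₀ = G₃² is a positive real number. -/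

import Mathlib

open Matrix Kronecker

noncomputable section

/-- `L0 = diag(√3, 1/√3, 0, -1/√3, -√3)`. -/
def L0d : Matrix (Fin 5) (Fin 5) ℝ :=
  Matrix.diagonal ![Real.sqrt 3, 1 / Real.sqrt 3, 0, -(1 / Real.sqrt 3), -Real.sqrt 3]

/-- The family `L(t) = cos(t)·L0 + sin(t)·L1` is isospectral: for every `t` the matrix
`L(t)` has eigenvalues exactly `-√3, -1/√3, 0, 1/√3, √3`, each with multiplicity one,
i.e. its characteristic polynomial is `X·(X² - 3)·(X² - 1/3)`. -/
def Isospectral (L1 : Matrix (Fin 5) (Fin 5) ℝ) : Prop :=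
  ∀ t : ℝ, (Real.cos t • L0d + Real.sin t • L1).charpoly =
    Polynomial.X * (Polynomial.X ^ 2 - Polynomial.C 3) *
      (Polynomial.X ^ 2 - Polynomial.C (1 / 3 : ℝ))

/-- `L₊ = ½(L0 - i·L1)`, viewed as a complex matrix. -/
def LplusF (L1 : Matrix (Fin 5) (Fin 5) ℝ) : Matrix (Fin 5) (Fin 5) ℂ :=
  (1 / 2 : ℂ) • (L0d.map Complex.ofReal - Complex.I • L1.map Complex.ofReal)

/-- `E`: the real subspace of `ℝ⁵` spanned by the kernels `ker L(t)`, `t ∈ ℝ`. -/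
def Espan (L1 : Matrix (Fin 5) (Fin 5) ℝ) : Submodule ℝ (Fin 5 → ℝ) :=
  ⨆ t : ℝ, LinearMap.ker (Real.cos t • L0d + Real.sin t • L1).mulVecLin

/-- The isotropic vector `e₊ = (e₁ + i·e₂)/√2` of `ℂ²`, as a `2 × 1` column matrix. -/
def ePlus : Matrix (Fin 2) (Fin 1) ℂ :=
  !![1 / (Real.sqrt 2 : ℂ); Complex.I / (Real.sqrt 2 : ℂ)]

/-- `σ = e₊·e₊ᵀ = ½·[[1, i], [i, -1]] ∈ M₂(ℂ)`. -/
def sigmaC : Matrix (Fin 2) (Fin 2) ℂ := ePlus * ePlusᵀ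

/-- The canonical identification `Fin 2 ⊕ Fin 3 ≃ Fin 5`. -/
def eq235 : Fin 2 ⊕ Fin 3 ≃ Fin 5 := finSumFinEquiv.trans (finCongr (by norm_num))

/-- The canonical identification `Fin 2 ⊕ Fin 1 ≃ Fin 3`. -/
def eq213 : Fin 2 ⊕ Fin 1 ≃ Fin 3 := finSumFinEquiv.trans (finCongr (by norm_num))

/-- `e₊ ⊗ F₀` for a `1 × 3` row `F₀`, as a `2 × 3` matrix. -/
def eKron (F₀ : Matrix (Fin 1) (Fin 3) ℂ) : Matrix (Fin 2) (Fin 3) ℂ :=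
  Matrix.of fun i j => ePlus i 0 * F₀ 0 j

/-- The `3 × 3` symmetric matrix `G` whose upper-left `2 × 2` block is `G₁·σ`, whose last
column (resp. row) is `G₃·e₊` (resp. `G₃·e₊ᵀ`) and whose `(3,3)` entry vanishes. -/
def Gmat (G₁ G₃ : ℂ) : Matrix (Fin 3) (Fin 3) ℂ :=
  Matrix.reindex eq213 eq213
    (Matrix.fromBlocks (G₁ • sigmaC) (G₃ • ePlus) (G₃ • ePlusᵀ) (0 : Matrix (Fin 1) (Fin 1) ℂ))


theorem coeff_eq_zero_of_circle {n : ℕ} {a : Fin n → ℂ}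
    (h : ∀ s : Circle, ∑ k : Fin n, (s : ℂ) ^ (k : ℕ) * a k = 0) (k : Fin n) : a k = 0 := by
  have hinf : Infinite Circle := Circle.argEquiv.infinite_iff.2
    (Set.infinite_coe_iff.2 (Set.Ioc_infinite (by linarith [Real.pi_pos])))
  let p : Polynomial ℂ := ∑ k : Fin n, Polynomial.monomial k (a k)
  have hp : p = 0 := by
    refine Polynomial.eq_zero_of_infinite_isRoot p
      ((Set.infinite_range_of_injective (f := fun s : Circle => (s : ℂ))
        Circle.coe_injective).mono ?_)
    rintro _ ⟨s, rfl⟩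
    simpa [p, Polynomial.eval_finsetSum, mul_comm] using h s
  have := congrArg (fun q => Polynomial.coeff q k) hp
  simpa [p, Polynomial.finsetSum_coeff, Polynomial.coeff_monomial, Fin.val_inj] using this

/-- If `(s • N + M) ^ 5 = c s (s • N + M) ^ 3 - d s² (s • N + M)` on the unit circle, the
coefficients of `s⁵` and `s⁴` show that `N ^ 5 = 0` and compute the trace of `N ^ 4 * M`. -/
theorem add_smul_pow_coeff {m : Type*} [Fintype m] [DecidableEq m] {N M : Matrix m m ℂ} {c d : ℂ}
    (h : ∀ s : Circle, ((s : ℂ) • N + M) ^ 5 =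
      (c * s) • ((s : ℂ) • N + M) ^ 3 - (d * s ^ 2) • ((s : ℂ) • N + M)) :
    N ^ 5 = 0 ∧ 5 * (N ^ 4 * M).trace = c * (N ^ 3).trace := by
  have key : ∃ A₀ A₁ A₂ A₃ : Matrix m m ℂ, ∀ s : Circle,
      A₀ + (s : ℂ) • A₁ + (s : ℂ) ^ 2 • A₂ + (s : ℂ) ^ 3 • A₃ +
        (s : ℂ) ^ 4 • (N ^ 4 * M + N ^ 3 * M * N + N ^ 2 * M * N ^ 2 + N * M * N ^ 3 + M * N ^ 4
          - c • N ^ 3) + (s : ℂ) ^ 5 • N ^ 5 = 0 := by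
    refine ⟨M ^ 5,
      (N * M ^ 4 + M * N * M ^ 3 + M ^ 2 * N * M ^ 2 + M ^ 3 * N * M + M ^ 4 * N) - c • M ^ 3,
      (N * N * M * M * M + N * M * N * M * M + N * M * M * N * M + N * M * M * M * N
        + M * N * N * M * M + M * N * M * N * M + M * N * M * M * N
        + M * M * N * N * M + M * M * N * M * N + M * M * M * N * N)
        - c • (N * M * M + M * N * M + M * M * N) + d • M,
      (M * M * N * N * N + M * N * M * N * N + M * N * N * M * N + M * N * N * N * M
        + N * M * M * N * N + N * M * N * M * N + N * M * N * N * M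
        + N * N * M * M * N + N * N * M * N * M + N * N * N * M * M)
        - c • (M * N * N + N * M * N + N * N * M) + d • N, fun s => ?_⟩
    have := h s
    rw [← sub_eq_zero] at this
    rw [← this]
    simp only [pow_succ, pow_zero, one_mul, mul_add, add_mul, smul_mul_assoc, mul_smul_comm,
      mul_assoc]
    module
  obtain ⟨A₀, A₁, A₂, A₃, key⟩ := key
  have coeffs : ∀ φ : Matrix m m ℂ →ₗ[ℂ] ℂ, φ (N ^ 5) = 0 ∧
      φ (N ^ 4 * M + N ^ 3 * M * N + N ^ 2 * M * N ^ 2 + N * M * N ^ 3 + M * N ^ 4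
          - c • N ^ 3) = 0 := by
    intro φ
    have hs : ∀ s : Circle, ∑ k : Fin 6, (s : ℂ) ^ (k : ℕ) *
        (![φ A₀, φ A₁, φ A₂, φ A₃, φ (N ^ 4 * M + N ^ 3 * M * N + N ^ 2 * M * N ^ 2 + N * M * N ^ 3
          + M * N ^ 4 - c • N ^ 3), φ (N ^ 5)] : Fin 6 → ℂ) k = 0 := by
      intro s
      have := congrArg φ (key s)
      simp only [map_add, map_smul, map_zero, smul_eq_mul] at this
      simpa [Fin.sum_univ_succ, add_assoc] using this
    exact ⟨coeff_eq_zero_of_circle hs 5, coeff_eq_zero_of_circle hs 4⟩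
  constructor
  · ext i j
    exact (coeffs (Matrix.entryLinearMap ℂ ℂ i j)).1
  · have := (coeffs (Matrix.traceLinearMap m ℂ ℂ)).2
    simp only [map_add, map_sub, map_smul, Matrix.traceLinearMap_apply, smul_eq_mul] at this
    have e1 : (N ^ 3 * M * N).trace = (N ^ 4 * M).trace := by
      rw [Matrix.trace_mul_comm, ← mul_assoc, ← pow_succ']
    have e2 : (N ^ 2 * M * N ^ 2).trace = (N ^ 4 * M).trace := by
      rw [Matrix.trace_mul_comm, ← mul_assoc, ← pow_add]
    have e3 : (N * M * N ^ 3).trace = (N ^ 4 * M).trace := by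
      rw [Matrix.trace_mul_comm, ← mul_assoc, ← pow_succ]
    have e4 : (M * N ^ 4).trace = (N ^ 4 * M).trace := Matrix.trace_mul_comm _ _
    rw [e1, e2, e3, e4] at this
    linear_combination this

theorem exists_dotProduct_mulVec_eq_one {m : Type*} [Fintype m] [DecidableEq m] {S : Matrix m m ℂ}
    (hS : S.IsSymm) (h0 : S ≠ 0) : ∃ w : m → ℂ, w ⬝ᵥ S *ᵥ w = 1 := by
  obtain ⟨w, hw⟩ : ∃ w : m → ℂ, w ⬝ᵥ S *ᵥ w ≠ 0 := by
    by_contra! h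
    refine h0 ?_
    ext i j
    have h1 := h (Pi.single i 1 + Pi.single j 1)
    have hi := h (Pi.single i 1)
    have hj := h (Pi.single j 1)
    have hij := hS.apply i j
    simp [mulVec_add, add_dotProduct, dotProduct_add] at h1 hi hj ⊢
    rw [hi, hj, hij] at h1
    linear_combination h1 / 2
  obtain ⟨c, hc⟩ := IsAlgClosed.exists_pow_nat_eq (w ⬝ᵥ S *ᵥ w)⁻¹ (n := 2) (by norm_num)
  refine ⟨c • w, ?_⟩
  simp only [mulVec_smul, smul_dotProduct, dotProduct_smul, smul_eq_mul]
  rw [← mul_assoc, ← sq, hc, inv_mul_cancel₀ hw]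

/-- A nonzero isotropic complex vector is moved by a real orthogonal matrix to a positive multiple
of `e₁ + i e₂`. -/
theorem exists_orthogonal_mulVec_isotropic {ι : Type*} [Fintype ι] [DecidableEq ι]
    {v : Fin 2 ⊕ ι → ℂ} (hv : v ⬝ᵥ v = 0) (h0 : v ≠ 0) :
    ∃ (U : Matrix (Fin 2 ⊕ ι) (Fin 2 ⊕ ι) ℝ) (r : ℝ), 0 < r ∧ U * Uᵀ = 1 ∧
      U.map Complex.ofReal *ᵥ v = Sum.elim ((r : ℂ) • ![1, Complex.I]) 0 := by
  let a : EuclideanSpace ℝ (Fin 2 ⊕ ι) := WithLp.toLp 2 fun i => (v i).re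
  let b : EuclideanSpace ℝ (Fin 2 ⊕ ι) := WithLp.toLp 2 fun i => (v i).im
  have hva (x : EuclideanSpace ℝ (Fin 2 ⊕ ι)) : inner ℝ x a = ∑ i, x i * (v i).re := by
    rw [PiLp.inner_apply]
    exact Finset.sum_congr rfl fun i _ => mul_comm _ _
  have hvb (x : EuclideanSpace ℝ (Fin 2 ⊕ ι)) : inner ℝ x b = ∑ i, x i * (v i).im := by
    rw [PiLp.inner_apply]
    exact Finset.sum_congr rfl fun i _ => mul_comm _ _
  have hre : inner ℝ a a = inner ℝ b b := by
    have := congrArg Complex.re hv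
    simp only [dotProduct, Complex.re_sum, Complex.mul_re, Finset.sum_sub_distrib,
      Complex.zero_re] at this
    rw [hva, hvb]
    exact sub_eq_zero.1 this
  have him : inner ℝ a b = 0 := by
    have := congrArg Complex.im hv
    simp only [dotProduct, Complex.im_sum, Complex.mul_im, Finset.sum_add_distrib,
      Complex.zero_im] at this
    have h1 := hvb a
    have h2 := hva b
    rw [real_inner_comm] at h2
    change _ = ∑ i, (v i).re * (v i).im at h1
    change _ = ∑ i, (v i).im * (v i).re at h2
    linarith
  have hn : ‖b‖ = ‖a‖ := by
    rw [real_inner_self_eq_norm_sq, real_inner_self_eq_norm_sq] at hre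
    exact ((sq_eq_sq₀ (norm_nonneg _) (norm_nonneg _)).1 hre).symm
  have ha : ‖a‖ ≠ 0 := by
    intro h
    have ha : a = 0 := norm_eq_zero.1 h
    have hb : b = 0 := norm_eq_zero.1 (hn.trans h)
    refine h0 (funext fun i => Complex.ext ?_ ?_)
    · exact congrArg (fun x : EuclideanSpace ℝ (Fin 2 ⊕ ι) => x i) ha
    · exact congrArg (fun x : EuclideanSpace ℝ (Fin 2 ⊕ ι) => x i) hb
  let f : Fin 2 ⊕ ι → EuclideanSpace ℝ (Fin 2 ⊕ ι) := Sum.elim ![‖a‖⁻¹ • a, ‖a‖⁻¹ • b] 0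
  have hf : Orthonormal ℝ ((Set.range (Sum.inl : Fin 2 → Fin 2 ⊕ ι)).domRestrict f) := by
    rw [orthonormal_iff_ite]
    rintro ⟨_, i, rfl⟩ ⟨_, j, rfl⟩
    fin_cases i <;> fin_cases j <;>
      simp [Set.domRestrict, f, inner_smul_left, inner_smul_right, him, real_inner_comm a b,
        norm_smul, hn, ha]
  obtain ⟨B, hB⟩ := hf.exists_orthonormalBasis_extension_of_card_eq (by simp)
  have hUv : ∀ i, (∑ j, ((B i j : ℝ) : ℂ) * v j) = (inner ℝ (B i) a : ℝ) + (inner ℝ (B i) b : ℝ) * Complex.I := by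
    intro i
    rw [hva, hvb]
    apply Complex.ext <;> simp only [Complex.re_sum, Complex.im_sum] <;> simp
  have h_0 : B (Sum.inl 0) = ‖a‖⁻¹ • a := hB _ ⟨0, rfl⟩
  have h_1 : B (Sum.inl 1) = ‖a‖⁻¹ • b := hB _ ⟨1, rfl⟩
  have ea : a = ‖a‖ • B (Sum.inl 0) := by rw [h_0, smul_smul, mul_inv_cancel₀ ha, one_smul]
  have eb : b = ‖a‖ • B (Sum.inl 1) := by rw [h_1, smul_smul, mul_inv_cancel₀ ha, one_smul]
  refine ⟨Matrix.of fun i j => B i j, ‖a‖, lt_of_le_of_ne (norm_nonneg _) ha.symm, ?_, ?_⟩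
  · ext i j
    have := orthonormal_iff_ite.1 B.orthonormal i j
    rw [PiLp.inner_apply] at this
    simpa [Matrix.mul_apply, Matrix.one_apply, mul_comm] using this
  · funext i
    have h1 : (Matrix.map (Matrix.of fun i j => B i j) Complex.ofReal *ᵥ v) i = ∑ j, ((B i j : ℝ) : ℂ) * v j := rfl
    have hia : inner ℝ (B i) a = if i = Sum.inl 0 then ‖a‖ else 0 := by
      conv_lhs => rw [ea, inner_smul_right, orthonormal_iff_ite.1 B.orthonormal]
      simp
    have hib : inner ℝ (B i) b = if i = Sum.inl 1 then ‖a‖ else 0 := by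
      conv_lhs => rw [eb, inner_smul_right, orthonormal_iff_ite.1 B.orthonormal]
      simp
    rw [h1, hUv, hia, hib]
    rcases i with i | i
    · fin_cases i <;> simp
    · simp

theorem isospectral_pow_five {L1 : Matrix (Fin 5) (Fin 5) ℝ} (hiso : Isospectral L1) (t : ℝ) :
    (Real.cos t • L0d + Real.sin t • L1) ^ 5 =
      (10 / 3 : ℝ) • (Real.cos t • L0d + Real.sin t • L1) ^ 3 -
        (Real.cos t • L0d + Real.sin t • L1) := by
  set L := Real.cos t • L0d + Real.sin t • L1 with hL
  have h := Matrix.aeval_self_charpoly L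
  rw [hL, hiso t, ← hL] at h
  have hp : (Polynomial.X * (Polynomial.X ^ 2 - Polynomial.C 3) *
      (Polynomial.X ^ 2 - Polynomial.C (1 / 3 : ℝ))) =
      Polynomial.X ^ 5 - Polynomial.C (10 / 3) * Polynomial.X ^ 3 + Polynomial.X := by
    have h3 : (Polynomial.C 3 * Polynomial.C (1 / 3) : Polynomial ℝ) = 1 := by
      rw [← Polynomial.C_mul]; norm_num
    have h10 : (Polynomial.C (10 / 3) : Polynomial ℝ) =
        Polynomial.C 3 + Polynomial.C (1 / 3) := by
      rw [← Polynomial.C_add]; norm_num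
    rw [h10]
    linear_combination Polynomial.X * h3
  rw [hp] at h
  simp only [map_add, map_sub, map_mul, map_pow, Polynomial.aeval_X, Polynomial.aeval_C,
    Algebra.algebraMap_eq_smul_one, smul_mul_assoc, one_mul] at h
  rw [← sub_eq_zero, ← h]
  abel

theorem LplusF_smul_add (L1 : Matrix (Fin 5) (Fin 5) ℝ) (t : ℝ) :
    Complex.exp (t * Complex.I) • LplusF L1 +
      Complex.exp (-t * Complex.I) • (LplusF L1).map (starRingEnd ℂ) =
      (Real.cos t • L0d + Real.sin t • L1).map Complex.ofReal := by
  ext i j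
  simp only [LplusF, Matrix.add_apply, Matrix.smul_apply, Matrix.map_apply, Matrix.sub_apply,
    smul_eq_mul, map_mul, map_sub, map_div₀, map_one, map_ofNat, Complex.conj_I, Complex.conj_ofReal,
    Complex.ofReal_add, Complex.ofReal_mul, Complex.ofReal_cos, Complex.ofReal_sin,
    Complex.exp_mul_I, Complex.cos_neg, Complex.sin_neg]
  linear_combination -(Complex.sin t * (L1 i j)) * Complex.I_sq

theorem LplusF_nilpotent {L1 : Matrix (Fin 5) (Fin 5) ℝ} (hiso : Isospectral L1) :
    LplusF L1 ^ 5 = 0 ∧ (LplusF L1 ^ 4 * (LplusF L1).map (starRingEnd ℂ)).trace = 0 := by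
  have key := add_smul_pow_coeff (N := LplusF L1) (M := (LplusF L1).map (starRingEnd ℂ))
    (c := 10 / 3) (d := 1) fun s => by
      set t : ℝ := Complex.arg s / 2
      set z : ℂ := Complex.exp (t * Complex.I)
      have hz : z ≠ 0 := Complex.exp_ne_zero _
      have hzi : Complex.exp (-t * Complex.I) = z⁻¹ := by rw [neg_mul, Complex.exp_neg]
      have hs : (s : ℂ) = z ^ 2 := by
        rw [← Complex.exp_nat_mul]
        conv_lhs => rw [← Complex.norm_mul_exp_arg_mul_I (s : ℂ), Circle.norm_coe]
        simp only [t]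
        push_cast
        rw [one_mul]
        ring_nf
      have hL := LplusF_smul_add L1 t
      rw [hzi] at hL
      have h5 := congrArg (Complex.ofRealHom.mapMatrix) (isospectral_pow_five hiso t)
      have hsm : (s : ℂ) • LplusF L1 + (LplusF L1).map (starRingEnd ℂ) =
          z • Complex.ofRealHom.mapMatrix (Real.cos t • L0d + Real.sin t • L1) := by
        change _ = z • (Real.cos t • L0d + Real.sin t • L1).map Complex.ofReal
        rw [← hL, smul_add, smul_smul, smul_smul, mul_inv_cancel₀ hz, one_smul, hs, sq]
      have hsmul : ∀ (c : ℝ) (A : Matrix (Fin 5) (Fin 5) ℝ),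
          Complex.ofRealHom.mapMatrix (c • A) = (c : ℂ) • Complex.ofRealHom.mapMatrix A := by
        intro c A
        ext i j
        simp
      rw [map_sub, hsmul, map_pow, map_pow] at h5
      rw [hsm, smul_pow, smul_pow, h5, hs, smul_sub, smul_smul, smul_smul, smul_smul]
      push_cast
      congr 2 <;> ring
  refine ⟨key.1, ?_⟩
  have h3 : (LplusF L1 ^ 3).trace = 0 :=
    (Matrix.isNilpotent_trace_of_isNilpotent ⟨5, by
      rw [← pow_mul, mul_comm, pow_mul, key.1]; simp⟩).eq_zero
  have := key.2
  rw [h3] at this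
  linear_combination this / 5

theorem ePlus_transpose_mul_ePlus : ePlusᵀ * ePlus = 0 := by
  ext i j
  fin_cases i; fin_cases j
  simp [ePlus, Matrix.mul_apply, Fin.sum_univ_two, div_mul_div_comm]
  field_simp
  ring

theorem ePlus_mul_mul_transpose (X : Matrix (Fin 1) (Fin 1) ℂ) :
    ePlus * X * ePlusᵀ = X 0 0 • sigmaC := by
  ext i j
  simp [sigmaC, Matrix.mul_apply]
  ring

theorem sigmaC_mul_ePlus : sigmaC * ePlus = 0 := by
  rw [sigmaC, Matrix.mul_assoc, ePlus_transpose_mul_ePlus, Matrix.mul_zero]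

theorem ePlus_transpose_mul_sigmaC : ePlusᵀ * sigmaC = 0 := by
  rw [sigmaC, ← Matrix.mul_assoc, ePlus_transpose_mul_ePlus, Matrix.zero_mul]

theorem sigmaC_mul_sigmaC : sigmaC * sigmaC = 0 := by
  nth_rw 2 [sigmaC]
  rw [← Matrix.mul_assoc, sigmaC_mul_ePlus, Matrix.zero_mul]

theorem sigmaC_transpose : sigmaCᵀ = sigmaC := by simp [sigmaC]

theorem sigmaC_eq : sigmaC = (1 / 2 : ℂ) • !![1, Complex.I; Complex.I, -1] := by
  have h : ((Real.sqrt 2 : ℂ)⁻¹) ^ 2 = 1 / 2 := by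
    rw [inv_pow, ← Complex.ofReal_pow, Real.sq_sqrt (by norm_num)]
    norm_num
  ext i j
  fin_cases i <;> fin_cases j <;> simp [sigmaC, ePlus, Matrix.mul_apply]
  · linear_combination h
  · linear_combination Complex.I * h
  · linear_combination Complex.I * h
  · linear_combination Complex.I ^ 2 * h + Complex.I_sq / 2

theorem trace_sigmaC : sigmaC.trace = 0 := by
  simp [sigmaC_eq, Matrix.trace_fin_two]

theorem trace_sigmaC_mul_conj : (sigmaC * sigmaC.map (starRingEnd ℂ)).trace = 1 := by
  simp only [Matrix.trace_fin_two, Matrix.mul_apply, Fin.sum_univ_two, Matrix.map_apply]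
  simp [sigmaC_eq, Complex.conj_ofNat]
  linear_combination -Complex.I_sq / 2

theorem eKron_eq_mul (F : Matrix (Fin 1) (Fin 3) ℂ) : eKron F = ePlus * F := by
  ext i j
  simp [eKron, Matrix.mul_apply]

theorem exists_eq_fromBlocks_ePlus {ι : Type*} [Fintype ι]
    {M : Matrix (Fin 2 ⊕ ι) (Fin 2 ⊕ ι) ℂ} (hM : M.IsSymm)
    (h : M *ᵥ Sum.elim ![1, Complex.I] 0 = 0) :
    ∃ (α : ℂ) (F : Matrix (Fin 1) ι ℂ) (G : Matrix ι ι ℂ), G.IsSymm ∧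
      M = fromBlocks (α • sigmaC) (ePlus * F) (ePlus * F)ᵀ G := by
  have hc : ∀ i, M i (Sum.inl 0) + M i (Sum.inl 1) * Complex.I = 0 := fun i => by
    simpa [mulVec, dotProduct] using congrFun h i
  have hc' : ∀ i, M i (Sum.inl 1) = M i (Sum.inl 0) * Complex.I := fun i => by
    linear_combination -Complex.I * hc i + M i (Sum.inl 1) * Complex.I_sq
  have h2 : (Real.sqrt 2 : ℂ) ≠ 0 := by simp
  refine ⟨2 * M (Sum.inl 0) (Sum.inl 0),
    Matrix.of fun _ j => Real.sqrt 2 * M (Sum.inl 0) (Sum.inr j), M.toBlocks₂₂, ?_, ?_⟩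
  · ext i j
    exact hM.apply _ _
  · ext i j
    rcases i with i | i <;> rcases j with j | j
    · have h01 := hc' (Sum.inl 0)
      have h11 := hc' (Sum.inl 1)
      have hs := hM.apply (Sum.inl 0) (Sum.inl 1)
      fin_cases i <;> fin_cases j <;> simp [sigmaC_eq, hs, h01, h11]
      · ring
      · ring
      · ring
      · linear_combination M (Sum.inl 0) (Sum.inl 0) * Complex.I_sq
    · have h1 := hc' (Sum.inr j)
      have hs := hM.apply (Sum.inr j)
      rw [← hs, ← hs] at h1
      fin_cases i <;> simp [ePlus, h1]
      all_goals field_simp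
    · have h1 := hc' (Sum.inr i)
      have hs := hM.apply (Sum.inr i) (Sum.inl 0)
      fin_cases j <;> simp [ePlus, h1, hs]
      all_goals field_simp
    · rfl

section Blocks

variable {ι : Type*} [Fintype ι] [DecidableEq ι]

theorem fromBlocks_ePlus_sq (α : ℂ) (F : Matrix (Fin 1) ι ℂ) (G : Matrix ι ι ℂ) (hG : G.IsSymm) :
    fromBlocks (α • sigmaC) (ePlus * F) (ePlus * F)ᵀ G ^ 2 =
      fromBlocks ((F * Fᵀ) 0 0 • sigmaC) (ePlus * (F * G)) (ePlus * (F * G))ᵀ (G ^ 2) := by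
  rw [sq, fromBlocks_multiply, ← ePlus_mul_mul_transpose (F * Fᵀ)]
  congr 1
  · simp [sigmaC_mul_sigmaC, Matrix.mul_assoc]
  · simp [← Matrix.mul_assoc, sigmaC_mul_ePlus]
  · simp [Matrix.mul_assoc, ePlus_transpose_mul_sigmaC, hG.eq]
  · rw [transpose_mul, Matrix.mul_assoc, ← Matrix.mul_assoc ePlusᵀ, ePlus_transpose_mul_ePlus,
      sq]
    simp

theorem fromBlocks_ePlus_pow_four (α : ℂ) (F : Matrix (Fin 1) ι ℂ) (G : Matrix ι ι ℂ)
    (hG : G.IsSymm) :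
    fromBlocks (α • sigmaC) (ePlus * F) (ePlus * F)ᵀ G ^ 4 =
      fromBlocks ((F * G ^ 2 * Fᵀ : Matrix (Fin 1) (Fin 1) ℂ) 0 0 • sigmaC) (ePlus * (F * G ^ 3)) (ePlus * (F * G ^ 3))ᵀ
        (G ^ 4) := by
  rw [show 4 = 2 * 2 from rfl, pow_mul, fromBlocks_ePlus_sq _ _ _ hG,
    fromBlocks_ePlus_sq _ _ _ (hG.pow 2), ← pow_mul]
  have h3 : F * G * G ^ 2 = F * G ^ 3 := by rw [Matrix.mul_assoc, ← pow_succ']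
  have h2 : F * G * (F * G)ᵀ = F * G ^ 2 * Fᵀ := by
    rw [transpose_mul, hG.eq, sq]
    simp only [Matrix.mul_assoc]
  rw [h2, h3]

theorem map_ofReal_orthogonal {m : Type*} [Fintype m] [DecidableEq m] {U : Matrix m m ℝ}
    (hU : U * Uᵀ = 1) :
    U.map Complex.ofReal * (U.map Complex.ofReal)ᵀ = 1 ∧
      (U.map Complex.ofReal)ᵀ * U.map Complex.ofReal = 1 := by
  have h := congrArg Complex.ofRealHom.mapMatrix hU
  rw [map_mul, map_one] at h
  exact ⟨h, mul_eq_one_comm.1 h⟩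

theorem conj_pow_of_mul_eq_one {R : Type*} [Monoid R] {u v : R} (h : v * u = 1) (x : R)
    {k : ℕ} (hk : k ≠ 0) : (u * x * v) ^ k = u * x ^ k * v := by
  induction k with
  | zero => exact absurd rfl hk
  | succ k ih =>
    rcases eq_or_ne k 0 with rfl | hk'
    · simp
    · rw [pow_succ, ih hk', pow_succ]
      simp only [mul_assoc]
      rw [← mul_assoc v u, h, one_mul]

theorem exists_orthogonal_fromBlocks_ePlus {M : Matrix (Fin 2 ⊕ ι) (Fin 2 ⊕ ι) ℂ}
    (hM : M.IsSymm) {k : ℕ} (hk : k ≠ 0) (h0 : M ^ k ≠ 0) (h1 : M ^ (k + 1) = 0) :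
    ∃ (U : Matrix (Fin 2 ⊕ ι) (Fin 2 ⊕ ι) ℝ) (α : ℂ) (F : Matrix (Fin 1) ι ℂ)
      (G : Matrix ι ι ℂ) (r : ℝ) (w : Fin 2 ⊕ ι → ℂ), U * Uᵀ = 1 ∧ G.IsSymm ∧ 0 < r ∧
      U.map Complex.ofReal * M * (U.map Complex.ofReal)ᵀ =
        fromBlocks (α • sigmaC) (ePlus * F) (ePlus * F)ᵀ G ∧
      w ⬝ᵥ (U.map Complex.ofReal * M * (U.map Complex.ofReal)ᵀ) ^ k *ᵥ w = 1 ∧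
      (U.map Complex.ofReal * M * (U.map Complex.ofReal)ᵀ) ^ k *ᵥ w =
        Sum.elim ((r : ℂ) • ![1, Complex.I]) 0 := by
  obtain ⟨w, hw⟩ := exists_dotProduct_mulVec_eq_one (hM.pow k) h0
  have hv0 : M ^ k *ᵥ w ≠ 0 := by
    intro h
    simp [h] at hw
  have hvv : (M ^ k *ᵥ w) ⬝ᵥ (M ^ k *ᵥ w) = 0 := by
    have h2 : M ^ k * M ^ k = 0 := by
      rw [← pow_add, show k + k = (k + 1) + (k - 1) by omega, pow_add, h1, Matrix.zero_mul]
    rw [dotProduct_mulVec, ← mulVec_transpose, (hM.pow k).eq, mulVec_mulVec, h2]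
    simp
  obtain ⟨U, r, hr, hU, hUv⟩ := exists_orthogonal_mulVec_isotropic hvv hv0
  obtain ⟨hUU, hUU'⟩ := map_ofReal_orthogonal hU
  set V := U.map Complex.ofReal
  have hVw : (V * M * Vᵀ) ^ k *ᵥ (V *ᵥ w) = Sum.elim ((r : ℂ) • ![1, Complex.I]) 0 := by
    rw [conj_pow_of_mul_eq_one hUU' M hk, mulVec_mulVec, Matrix.mul_assoc, hUU', Matrix.mul_one,
      ← mulVec_mulVec, hUv]
  have hker : (V * M * Vᵀ) *ᵥ Sum.elim ![1, Complex.I] 0 = 0 := by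
    have h2 : (V * M * Vᵀ) *ᵥ Sum.elim ((r : ℂ) • ![1, Complex.I]) 0 = 0 := by
      rw [← hVw, mulVec_mulVec, ← pow_succ', conj_pow_of_mul_eq_one hUU' M k.succ_ne_zero, h1]
      simp
    have h3 : (Sum.elim ((r : ℂ) • ![1, Complex.I]) 0 : Fin 2 ⊕ ι → ℂ) =
        (r : ℂ) • Sum.elim ![1, Complex.I] 0 := by
      ext i
      rcases i with i | i <;> simp [-smul_cons]
    rw [h3, mulVec_smul] at h2
    exact (smul_eq_zero.1 h2).resolve_left (by exact_mod_cast hr.ne')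
  have hsymm : (V * M * Vᵀ).IsSymm := by
    simp [Matrix.IsSymm, transpose_mul, hM.eq, Matrix.mul_assoc]
  obtain ⟨α, F, G, hG, hMG⟩ := exists_eq_fromBlocks_ePlus hsymm hker
  refine ⟨U, α, F, G, r, V *ᵥ w, hU, hG, hr, hMG, ?_, hVw⟩
  rw [hVw, ← hUv, dotProduct_mulVec, ← mulVec_transpose, mulVec_mulVec, hUU', one_mulVec, hw]

end Blocks

theorem pow_card_eq_zero_of_isNilpotent {m : Type*} [Fintype m] [DecidableEq m]
    {G : Matrix m m ℂ} (hG : IsNilpotent G) : G ^ Fintype.card m = 0 := by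
  have h := Matrix.aeval_self_charpoly G
  rw [sub_eq_zero.1 (Matrix.isNilpotent_charpoly_sub_pow_of_isNilpotent hG).eq_zero] at h
  simpa using h

theorem trace_fromBlocks_eq {m n : Type*} [Fintype m] [Fintype n] (A : Matrix m m ℂ)
    (B : Matrix m n ℂ) (C : Matrix n m ℂ) (D : Matrix n n ℂ) :
    (fromBlocks A B C D).trace = A.trace + D.trace := by
  simp [Matrix.trace]

theorem orthogonal_reindex {m n : Type*} [Fintype m] [Fintype n] [DecidableEq m] [DecidableEq n]
    (e : m ≃ n) {U : Matrix m m ℝ} (hU : U * Uᵀ = 1) :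
    reindex e e U * (reindex e e U)ᵀ = 1 := by
  rw [transpose_reindex, reindex_apply, reindex_apply, submatrix_mul_equiv, hU,
    submatrix_one_equiv]

theorem map_reindex_conj {m n : Type*} [Fintype m] [Fintype n]
    (e : m ≃ n) (U : Matrix m m ℝ) (A : Matrix n n ℂ) :
    (reindex e e U).map Complex.ofReal * A * ((reindex e e U).map Complex.ofReal)ᵀ =
      reindex e e (U.map Complex.ofReal * reindex e.symm e.symm A * (U.map Complex.ofReal)ᵀ) := by
  have hA : A = reindex e e (reindex e.symm e.symm A) := by
    ext i j
    simp
  conv_lhs => rw [hA]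
  simp only [reindex_apply]
  rw [← submatrix_map, transpose_submatrix, submatrix_mul_equiv, submatrix_mul_equiv]

theorem reindex_pow {m n : Type*} [Fintype m] [Fintype n] [DecidableEq m] [DecidableEq n]
    (e : m ≃ n) (A : Matrix m m ℂ) (k : ℕ) : reindex e e A ^ k = reindex e e (A ^ k) :=
  (map_pow (Matrix.reindexAlgEquiv ℂ ℂ e) A k).symm

theorem Gmat_isSymm (G₁ G₃ : ℂ) : (Gmat G₁ G₃).IsSymm := by
  simp only [Gmat, Matrix.IsSymm, transpose_reindex, fromBlocks_transpose, transpose_smul,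
    sigmaC_transpose, transpose_transpose, transpose_zero]

theorem exists_orthogonal_Gmat {G : Matrix (Fin 3) (Fin 3) ℂ} (hG : G.IsSymm) (h2 : G ^ 2 ≠ 0)
    (h3 : G ^ 3 = 0) :
    ∃ (U : Matrix (Fin 3) (Fin 3) ℝ) (G₁ G₃ : ℂ), U * Uᵀ = 1 ∧
      U.map Complex.ofReal * G * (U.map Complex.ofReal)ᵀ = Gmat G₁ G₃ ∧
      ∃ D₀ : ℝ, 0 < D₀ ∧ (D₀ : ℂ) = G₃ ^ 2 := by
  set M := reindex eq213.symm eq213.symm G with hMdef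
  have hMpow (k : ℕ) : M ^ k = reindex eq213.symm eq213.symm (G ^ k) := reindex_pow _ _ _
  have hM : M.IsSymm := by rw [hMdef, Matrix.IsSymm, transpose_reindex, hG.eq]
  have hM2 : M ^ 2 ≠ 0 := by
    rw [hMpow]
    exact fun h => h2 ((reindex eq213.symm eq213.symm).injective h)
  have hM3 : M ^ 3 = 0 := by
    rw [hMpow, h3]
    rfl
  obtain ⟨U, α, F, δ, r, w, hU, hδ, hr, hUM, hw1, hw2⟩ :=
    exists_orthogonal_fromBlocks_ePlus hM two_ne_zero hM2 hM3
  obtain ⟨-, hUU'⟩ := map_ofReal_orthogonal hU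
  have hδ0 : δ = 0 := by
    have hnil : IsNilpotent (U.map Complex.ofReal * M * (U.map Complex.ofReal)ᵀ) :=
      ⟨3, by rw [conj_pow_of_mul_eq_one hUU' _ three_ne_zero, hM3]; simp⟩
    have ht := (Matrix.isNilpotent_trace_of_isNilpotent hnil).eq_zero
    rw [hUM, trace_fromBlocks_eq, trace_smul, trace_sigmaC] at ht
    ext i j
    fin_cases i; fin_cases j
    simpa [Matrix.trace] using ht
  subst hδ0
  rw [hUM, fromBlocks_ePlus_sq _ _ _ hδ] at hw1 hw2
  rw [hw2] at hw1
  have hw3 := congrFun hw2 (Sum.inl 0)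
  have hFF : (F * Fᵀ) 0 0 = F 0 0 ^ 2 := by simp [Matrix.mul_apply, sq]
  have hF : ePlus * F = F 0 0 • ePlus := by
    ext i j
    fin_cases j
    simp [Matrix.mul_apply]
    ring
  refine ⟨reindex eq213 eq213 U, α, F 0 0, orthogonal_reindex _ hU, ?_, 2 * r ^ 2, by positivity, ?_⟩
  · rw [map_reindex_conj, ← hMdef, hUM, hF, transpose_smul]
    rfl
  · rw [hFF] at hw3
    simp [mulVec, dotProduct, sigmaC_eq] at hw3 hw1
    push_cast
    linear_combination (-2 * (r : ℂ)) * hw3 + F 0 0 ^ 2 * hw1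

theorem exists_orthogonal_fromBlocks_Gmat {M : Matrix (Fin 2 ⊕ Fin 3) (Fin 2 ⊕ Fin 3) ℂ}
    (hM : M.IsSymm) (h4 : M ^ 4 ≠ 0) (h5 : M ^ 5 = 0)
    (htr : (M ^ 4 * M.map (starRingEnd ℂ)).trace = 0) :
    ∃ (U : Matrix (Fin 2 ⊕ Fin 3) (Fin 2 ⊕ Fin 3) ℝ) (F₀ : Matrix (Fin 1) (Fin 3) ℂ) (G₁ G₃ : ℂ),
      U * Uᵀ = 1 ∧
      U.map Complex.ofReal * M * (U.map Complex.ofReal)ᵀ =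
        fromBlocks 0 (ePlus * F₀) (ePlus * F₀)ᵀ (Gmat G₁ G₃) ∧
      Gmat G₁ G₃ ^ 3 = 0 ∧ ∃ D₀ : ℝ, 0 < D₀ ∧ (D₀ : ℂ) = G₃ ^ 2 := by
  obtain ⟨U, α, F, G, -, -, hU, hG, -, hUM, -, -⟩ :=
    exists_orthogonal_fromBlocks_ePlus hM four_ne_zero h4 h5
  obtain ⟨-, hUU'⟩ := map_ofReal_orthogonal hU
  have hUstar : (U.map Complex.ofReal).map (starRingEnd ℂ) = U.map Complex.ofReal := by
    ext i j
    simp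
  have hpow (k : ℕ) (hk : k ≠ 0) :
      fromBlocks (α • sigmaC) (ePlus * F) (ePlus * F)ᵀ G ^ k =
        U.map Complex.ofReal * M ^ k * (U.map Complex.ofReal)ᵀ := by
    rw [← hUM, conj_pow_of_mul_eq_one hUU' _ hk]
  have hmap : (fromBlocks (α • sigmaC) (ePlus * F) (ePlus * F)ᵀ G).map (starRingEnd ℂ) =
      U.map Complex.ofReal * M.map (starRingEnd ℂ) * (U.map Complex.ofReal)ᵀ := by
    rw [← hUM, Matrix.map_mul, Matrix.map_mul, transpose_map, hUstar]
  set V := U.map Complex.ofReal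
  have hpow4 := fromBlocks_ePlus_pow_four α F G hG
  have hnil : IsNilpotent G := by
    refine ⟨8, ?_⟩
    have h8 := hpow 8 (by norm_num)
    rw [show 8 = 5 + 3 from rfl, pow_add M, h5, Matrix.zero_mul, Matrix.mul_zero,
      Matrix.zero_mul, show 5 + 3 = 4 * 2 from rfl, pow_mul, hpow4,
      fromBlocks_ePlus_sq _ _ _ (hG.pow 4), ← pow_mul] at h8
    have h22 := congrArg toBlocks₂₂ h8
    rw [toBlocks_fromBlocks₂₂] at h22
    exact h22
  have hG3 : G ^ 3 = 0 := pow_card_eq_zero_of_isNilpotent hnil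
  have hG4 : G ^ 4 = 0 := by rw [pow_succ, hG3, Matrix.zero_mul]
  set c := (F * G ^ 2 * Fᵀ : Matrix (Fin 1) (Fin 1) ℂ) 0 0 with hc
  rw [hG3, hG4] at hpow4
  simp only [Matrix.mul_zero, transpose_zero] at hpow4
  have hc0 : c ≠ 0 := by
    intro h
    rw [h, zero_smul, fromBlocks_zero, hpow 4 four_ne_zero] at hpow4
    apply h4
    calc M ^ 4 = (Vᵀ * V) * M ^ 4 * (Vᵀ * V) := by rw [hUU']; simp
      _ = Vᵀ * (V * M ^ 4 * Vᵀ) * V := by simp only [Matrix.mul_assoc]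
      _ = 0 := by rw [hpow4]; simp
  have hα : α = 0 := by
    have ht : (fromBlocks (α • sigmaC) (ePlus * F) (ePlus * F)ᵀ G ^ 4 *
        (fromBlocks (α • sigmaC) (ePlus * F) (ePlus * F)ᵀ G).map (starRingEnd ℂ)).trace = 0 := by
      rw [hpow 4 four_ne_zero, hmap]
      calc _ = (V * (M ^ 4 * ((Vᵀ * V) * M.map (starRingEnd ℂ))) * Vᵀ).trace := by
            simp only [Matrix.mul_assoc]
        _ = 0 := by
            rw [hUU', Matrix.one_mul, Matrix.trace_mul_comm, ← Matrix.mul_assoc, hUU',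
              Matrix.one_mul, htr]
    have hs : (α • sigmaC).map (starRingEnd ℂ) =
        starRingEnd ℂ α • sigmaC.map (starRingEnd ℂ) := by
      ext i j
      simp
    rw [hpow4, fromBlocks_map, fromBlocks_multiply, trace_fromBlocks_eq, hs] at ht
    simpa [trace_sigmaC_mul_conj, hc0] using ht
  subst hα
  have hG2 : G ^ 2 ≠ 0 := by
    intro h
    rw [h] at hc
    exact hc0 (by simpa using hc)
  obtain ⟨W, G₁, G₃, hW, hWG, hD⟩ := exists_orthogonal_Gmat hG hG2 hG3
  obtain ⟨hWW, hWW'⟩ := map_ofReal_orthogonal hW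
  have hWmap : (fromBlocks (1 : Matrix (Fin 2) (Fin 2) ℝ) 0 0 W).map Complex.ofReal =
      fromBlocks 1 0 0 (W.map Complex.ofReal) := by
    rw [fromBlocks_map]
    simp
  refine ⟨fromBlocks 1 0 0 W * U, F * (W.map Complex.ofReal)ᵀ, G₁, G₃, ?_, ?_, ?_, hD⟩
  · rw [transpose_mul, Matrix.mul_assoc, ← Matrix.mul_assoc U, hU, Matrix.one_mul,
      fromBlocks_transpose, fromBlocks_multiply, hW]
    simp
  · have hmul : (fromBlocks 1 0 0 W * U).map Complex.ofReal =
        fromBlocks 1 0 0 (W.map Complex.ofReal) * V := by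
      rw [← hWmap]
      exact Matrix.map_mul (f := Complex.ofRealHom)
    rw [hmul, transpose_mul]
    calc _ = fromBlocks 1 0 0 (W.map Complex.ofReal) * (V * M * Vᵀ) *
          (fromBlocks 1 0 0 (W.map Complex.ofReal))ᵀ := by simp only [Matrix.mul_assoc]
      _ = _ := by
          rw [hUM, fromBlocks_transpose, fromBlocks_multiply, fromBlocks_multiply, ← hWG]
          simp [Matrix.mul_assoc, transpose_mul]
  · rw [← hWG, conj_pow_of_mul_eq_one hWW' _ three_ne_zero, hG3]
    simp

/-- if `L(t) = cos(t)·L0 + sin(t)·L1` is isospectral and `P₄ = L₊⁴ ≠ 0`,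
then, up to conjugation by a real orthogonal matrix `U`, the matrix `L₊` has the block
form `[[0, e₊⊗F₀], [e₊ᵀ⊗F₀ᵀ, G]]` with `G` as in `Gmat`; moreover
`P₄` has upper-left block `(F₀·G²·F₀ᵀ)·σ` and zeros elsewhere, `L₊²` has the block form of
Lemma `prol2` with `B₀ = F₀·F₀ᵀ`, `C₀ = F₀·G`, `D = G²`, `d₂ = 1`, and `D₀ = G₃²` is a
positive real number. -/
theorem statement11 (L1 : Matrix (Fin 5) (Fin 5) ℝ) (hsymm : L1.IsSymm)
    (hiso : Isospectral L1) (hP4 : LplusF L1 ^ 4 ≠ 0) :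
    ∃ (U : Matrix (Fin 5) (Fin 5) ℝ) (F₀ : Matrix (Fin 1) (Fin 3) ℂ) (G₁ G₃ : ℂ),
      U * Uᵀ = 1 ∧
      U.map Complex.ofReal * LplusF L1 * (U.map Complex.ofReal)ᵀ =
        Matrix.reindex eq235 eq235
          (Matrix.fromBlocks (0 : Matrix (Fin 2) (Fin 2) ℂ) (eKron F₀) (eKron F₀)ᵀ
            (Gmat G₁ G₃)) ∧
      U.map Complex.ofReal * LplusF L1 ^ 4 * (U.map Complex.ofReal)ᵀ =
        Matrix.reindex eq235 eq235
          (Matrix.fromBlocks (((F₀ * Gmat G₁ G₃ ^ 2 * F₀ᵀ : Matrix (Fin 1) (Fin 1) ℂ) 0 0) • sigmaC) 0 0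
            (0 : Matrix (Fin 3) (Fin 3) ℂ)) ∧
      U.map Complex.ofReal * LplusF L1 ^ 2 * (U.map Complex.ofReal)ᵀ =
        Matrix.reindex eq235 eq235
          (Matrix.fromBlocks (((F₀ * F₀ᵀ : Matrix (Fin 1) (Fin 1) ℂ) 0 0) • sigmaC) (eKron (F₀ * Gmat G₁ G₃))
            (eKron (F₀ * Gmat G₁ G₃))ᵀ (Gmat G₁ G₃ ^ 2)) ∧
      ∃ D₀ : ℝ, 0 < D₀ ∧ (D₀ : ℂ) = G₃ ^ 2 := by
  set e := eq235
  have hN : (LplusF L1).IsSymm := by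
    have hL0 : L0dᵀ = L0d := Matrix.diagonal_transpose _
    rw [Matrix.IsSymm, LplusF, transpose_smul, transpose_sub, transpose_smul, ← transpose_map,
      ← transpose_map, hL0, hsymm.eq]
  obtain ⟨h5, htr⟩ := LplusF_nilpotent hiso
  have hpow (k : ℕ) := reindex_pow e.symm (LplusF L1) k
  obtain ⟨U, F₀, G₁, G₃, hU, hUM, hG3, hD⟩ :=
    exists_orthogonal_fromBlocks_Gmat (M := reindex e.symm e.symm (LplusF L1))
      (by rw [Matrix.IsSymm, transpose_reindex, hN.eq])
      (by
        rw [hpow]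
        exact fun h => hP4 ((reindex e.symm e.symm).injective h))
      (by rw [hpow, h5]; rfl)
      (by
        rw [hpow, reindex_apply, reindex_apply, ← submatrix_map, submatrix_mul_equiv]
        rw [← htr]
        exact Equiv.sum_comp e fun i => (LplusF L1 ^ 4 * (LplusF L1).map (starRingEnd ℂ)) i i)
  obtain ⟨-, hUU'⟩ := map_ofReal_orthogonal hU
  have hG := Gmat_isSymm G₁ G₃
  have hG4 : Gmat G₁ G₃ ^ 4 = 0 := by rw [pow_succ, hG3, Matrix.zero_mul]
  have h2 := fromBlocks_ePlus_sq 0 F₀ _ hG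
  have h4 := fromBlocks_ePlus_pow_four 0 F₀ _ hG
  rw [zero_smul, ← hUM, conj_pow_of_mul_eq_one hUU' _ two_ne_zero, hpow] at h2
  rw [zero_smul, ← hUM, conj_pow_of_mul_eq_one hUU' _ four_ne_zero, hpow, hG3, hG4] at h4
  refine ⟨reindex e e U, F₀, G₁, G₃, orthogonal_reindex e hU, ?_, ?_, ?_, hD⟩
  · rw [map_reindex_conj, hUM, eKron_eq_mul]
  · rw [map_reindex_conj, h4]
    simp
  · rw [map_reindex_conj, h2, eKron_eq_mul]

end
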